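/- Define, for ν ∈ ℂ, the harmonic function Y_ν : ℂ → ℂ by Y_ν(α) := exp(ν·conj(α) − α·conj(ν)), and the weight factor γ_ν := exp(−|ν|²/2). Then for all μ, ν, α ∈ ℂ and all s ∈ ℝ, the double series ∑_{k≥0} ∑_{l≥0} (1/(k!·l!))·((1−s)/2)^k·(−(1+s)/2)^l·(∂_α^k ∂_{α*}^l [γ_μ^{−s} Y_μ])(α)·(∂_{α*}^k ∂_α^l [γ_ν^{−s} Y_ν])(α) converges absolutely and equals exp((μ·conj(ν) − ν·conj(μ))/2)·γ_{μ+ν}^{−s}·Y_{μ+ν}(α). That is, the s-parametrized bidifferential star product exp[((1−s)/2)·(←∂_α)(→∂_{α*}) − ((1+s)/2)·(←∂_{α*})(→∂_α)] satisfies its defining property on the phase-space representations γ_ν^{−s}·Y_ν of the displacement operators. -/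

import Mathlib

open Complex

/-- Wirtinger derivative `∂_α f = (∂_x f − i ∂_y f)/2`. -/
noncomputable def wirt (f : ℂ → ℂ) : ℂ → ℂ :=
  fun z => (fderiv ℝ f z 1 - Complex.I * fderiv ℝ f z Complex.I) / 2

/-- Conjugate Wirtinger derivative `∂_{α*} f = (∂_x f + i ∂_y f)/2`. -/
noncomputable def wirtBar (f : ℂ → ℂ) : ℂ → ℂ :=
  fun z => (fderiv ℝ f z 1 + Complex.I * fderiv ℝ f z Complex.I) / 2

/-- The harmonic function `Y_ν(α) = exp(ν ᾱ − α ν̄)`. -/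
noncomputable def Yharm (ν : ℂ) (α : ℂ) : ℂ :=
  Complex.exp (ν * starRingEnd ℂ α - α * starRingEnd ℂ ν)

/-- The weight factor `γ_ν = exp(−|ν|²/2)`. -/
noncomputable def gammaNu (ν : ℂ) : ℝ := Real.exp (-‖ν‖ ^ 2 / 2)

/-- The `s`-parametrized phase-space representation `γ_ν^{−s} Y_ν` of the displacement
operator `T_ν`. -/
noncomputable def dispRep (s : ℝ) (ν : ℂ) : ℂ → ℂ :=
  fun α => ((gammaNu ν ^ (-s) : ℝ) : ℂ) * Yharm ν α

/-- The `(k,l)` term of the `s`-parametrized bidifferential star-product series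
`exp[((1−s)/2)(←∂_α)(→∂_{α*}) − ((1+s)/2)(←∂_{α*})(→∂_α)]` applied to
`γ_μ^{−s} Y_μ` and `γ_ν^{−s} Y_ν`, evaluated at `α`. -/
noncomputable def starTerm (s : ℝ) (μ ν α : ℂ) (kl : ℕ × ℕ) : ℂ :=
  (1 / ((Nat.factorial kl.1 : ℂ) * (Nat.factorial kl.2 : ℂ))) *
    (((1 - s) / 2 : ℂ) ^ kl.1) * ((-((1 + s) / 2) : ℂ) ^ kl.2) *
    (wirt^[kl.1] (wirtBar^[kl.2] (dispRep s μ))) α *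
    (wirtBar^[kl.1] (wirt^[kl.2] (dispRep s ν))) α

theorem aux_fd (c ν z v : ℂ) : fderiv ℝ (fun α => c * Yharm ν α) z v =
    (ν * starRingEnd ℂ v - v * starRingEnd ℂ ν) * (c * Yharm ν z) := by
  have h1 : HasFDerivAt (fun α : ℂ => ν * starRingEnd ℂ α - α * starRingEnd ℂ ν)
      (ν • (Complex.conjCLE : ℂ →L[ℝ] ℂ) -
        (starRingEnd ℂ ν) • (ContinuousLinearMap.id ℝ ℂ)) z := by
    have a : HasFDerivAt (fun α : ℂ => ν * starRingEnd ℂ α)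
        (ν • (Complex.conjCLE : ℂ →L[ℝ] ℂ)) z :=
      (Complex.conjCLE : ℂ →L[ℝ] ℂ).hasFDerivAt.const_mul ν
    have b : HasFDerivAt (fun α : ℂ => α * starRingEnd ℂ ν)
        ((starRingEnd ℂ ν) • (ContinuousLinearMap.id ℝ ℂ)) z :=
      (hasFDerivAt_id (𝕜 := ℝ) z).mul_const' (starRingEnd ℂ ν) |>.congr_fderiv (by
        ext; simp)
    exact a.sub b
  have h2 := (h1.cexp).const_mul c
  have h3 : HasFDerivAt (fun α => c * Yharm ν α) _ z := h2
  rw [h3.fderiv]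
  simp [Yharm]
  ring

theorem aux_wirt (c ν : ℂ) : wirt (fun α => c * Yharm ν α) =
    fun α => (-(starRingEnd ℂ ν) * c) * Yharm ν α := by
  funext z
  simp only [wirt, aux_fd, map_one, Complex.conj_I]
  linear_combination (-c * Yharm ν z / 2 * (-ν - starRingEnd ℂ ν)) * Complex.I_mul_I

theorem aux_wirtBar (c ν : ℂ) : wirtBar (fun α => c * Yharm ν α) =
    fun α => (ν * c) * Yharm ν α := by
  funext z
  simp only [wirtBar, aux_fd, map_one, Complex.conj_I]
  linear_combination (c * Yharm ν z / 2 * (-ν - starRingEnd ℂ ν)) * Complex.I_mul_I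

theorem aux_wirt_iter (c ν : ℂ) (n : ℕ) : wirt^[n] (fun α => c * Yharm ν α) =
    fun α => ((-(starRingEnd ℂ ν)) ^ n * c) * Yharm ν α := by
  induction n with
  | zero => simp
  | succ n ih =>
    rw [Function.iterate_succ_apply', ih, aux_wirt]
    funext z
    ring

theorem aux_wirtBar_iter (c ν : ℂ) (n : ℕ) : wirtBar^[n] (fun α => c * Yharm ν α) =
    fun α => (ν ^ n * c) * Yharm ν α := by
  induction n with
  | zero => simp
  | succ n ih =>
    rw [Function.iterate_succ_apply', ih, aux_wirtBar]
    funext z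
    ring

theorem aux_gamma (s : ℝ) (ν : ℂ) : ((gammaNu ν ^ (-s) : ℝ) : ℂ) =
    Complex.exp (s * (ν * starRingEnd ℂ ν) / 2) := by
  rw [gammaNu, ← Real.exp_mul, Complex.mul_conj, Complex.normSq_eq_norm_sq]
  push_cast
  congr 1
  ring

theorem aux_term (s : ℝ) (μ ν α : ℂ) (kl : ℕ × ℕ) : starTerm s μ ν α kl =
    (dispRep s μ α * dispRep s ν α) *
    (((((1 - s) / 2 : ℂ) * (-(starRingEnd ℂ μ)) * ν) ^ kl.1 / (Nat.factorial kl.1 : ℂ)) *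
     (((-((1 + s) / 2) : ℂ) * μ * (-(starRingEnd ℂ ν))) ^ kl.2 / (Nat.factorial kl.2 : ℂ))) := by
  unfold starTerm dispRep
  rw [aux_wirtBar_iter, aux_wirt_iter, aux_wirt_iter, aux_wirtBar_iter]
  simp only [mul_pow, div_eq_mul_inv, mul_inv]
  ring

theorem aux_sum (C x y : ℂ) (f : ℕ × ℕ → ℂ)
    (hf : ∀ kl, f kl = C * ((x ^ kl.1 / (Nat.factorial kl.1 : ℂ)) *
      (y ^ kl.2 / (Nat.factorial kl.2 : ℂ)))) :
    Summable (fun kl => ‖f kl‖) ∧ HasSum f (C * (Complex.exp x * Complex.exp y)) := by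
  have hs : ∀ x : ℂ, Summable (fun n : ℕ => ‖x ^ n / (Nat.factorial n : ℂ)‖) := fun x =>
    NormedSpace.norm_expSeries_div_summable x
  have he : ∀ x : ℂ, HasSum (fun n : ℕ => x ^ n / (Nat.factorial n : ℂ)) (Complex.exp x) := by
    intro x
    rw [Complex.exp_eq_exp_ℂ]
    exact NormedSpace.expSeries_div_hasSum_exp x
  have hf' : f = fun kl => C * ((x ^ kl.1 / (Nat.factorial kl.1 : ℂ)) *
      (y ^ kl.2 / (Nat.factorial kl.2 : ℂ))) := funext hf
  have h1 := summable_mul_of_summable_norm (hs x) (hs y)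
  have h2 := ((he x).mul (he y) h1).mul_left C
  rw [hf']
  exact ⟨(h1.mul_left C).norm, h2⟩

/-- The defining property of the `s`-parametrized star product on phase-space
representations of displacement operators: the double series converges absolutely and
`(γ_μ^{−s} Y_μ) ⋆^{(s)} (γ_ν^{−s} Y_ν) = exp((μν̄ − νμ̄)/2) γ_{μ+ν}^{−s} Y_{μ+ν}`. -/
theorem star_product_displacement (s : ℝ) (μ ν α : ℂ) :
    Summable (fun kl : ℕ × ℕ => ‖starTerm s μ ν α kl‖) ∧
    HasSum (fun kl : ℕ × ℕ => starTerm s μ ν α kl)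
      (Complex.exp ((μ * starRingEnd ℂ ν - ν * starRingEnd ℂ μ) / 2) *
        ((gammaNu (μ + ν) ^ (-s) : ℝ) : ℂ) * Yharm (μ + ν) α) := by
  have key := aux_sum _ _ _ _ (aux_term s μ ν α)
  refine ⟨key.1, ?_⟩
  have e : Complex.exp ((μ * starRingEnd ℂ ν - ν * starRingEnd ℂ μ) / 2) *
        ((gammaNu (μ + ν) ^ (-s) : ℝ) : ℂ) * Yharm (μ + ν) α =
      (dispRep s μ α * dispRep s ν α) *
      (Complex.exp (((1 - s) / 2 : ℂ) * (-(starRingEnd ℂ μ)) * ν) *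
       Complex.exp ((-((1 + s) / 2) : ℂ) * μ * (-(starRingEnd ℂ ν)))) := by
    simp only [dispRep, aux_gamma, Yharm, ← Complex.exp_add, map_add]
    congr 1
    ring
  rw [e]
  exact key.2
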